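/- Under the blow-up assumptions, |log Λ_α| = o(γ_α²) as α → λ₁⁻; equivalently, log(1/μ_α²) = (1 + o(1)) γ_α². -/

import Mathlib

open MeasureTheory intervalIntegral Real Filter Topology Metric Bornology RealInnerProductSpace

noncomputable section

/-- The Euclidean plane `ℝ²`. -/
abbrev E2 : Type := EuclideanSpace ℝ (Fin 2)

/-- The Laplacian with the paper's sign convention `Δ = −(∂²/∂x² + ∂²/∂y²)`. -/
def lapl (u : E2 → ℝ) (x : E2) : ℝ :=
  -(∑ i : Fin 2, iteratedFDeriv ℝ 2 u x ![EuclideanSpace.single i 1, EuclideanSpace.single i 1])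

/-- The second derivative of `u` in the direction `e`, written as an iterated directional
derivative. -/
lemma iteratedFDeriv_two_eq_fderiv_fderiv {u : E2 → ℝ} {y : E2} (hu : ContDiffAt ℝ 2 u y)
    (e : E2) :
    iteratedFDeriv ℝ 2 u y ![e, e] = fderiv ℝ (fun z => fderiv ℝ u z e) y e := by
  have h : DifferentiableAt ℝ (fderiv ℝ u) y :=
    (hu.fderiv_right (m := 1) (by norm_num)).differentiableAt (by norm_num)
  rw [iteratedFDeriv_two_apply, fderiv_clm_apply h (differentiableAt_const e)]
  simp

lemma lapl_eq_neg_sum {u : E2 → ℝ} {y : E2} (hu : ContDiffAt ℝ 2 u y) :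
    lapl u y = -∑ i : Fin 2, fderiv ℝ (fun z => fderiv ℝ u z (EuclideanSpace.single i 1)) y
      (EuclideanSpace.single i 1) := by
  simp only [lapl, iteratedFDeriv_two_eq_fderiv_fderiv hu]

lemma lapl_congr {u w : E2 → ℝ} {y : E2} (h : u =ᶠ[𝓝 y] w) : lapl u y = lapl w y := by
  simp only [lapl, h.iteratedFDeriv ℝ 2 |>.eq_of_nhds]

lemma norm_gradient_sq (u : E2 → ℝ) (y : E2) :
    ‖gradient u y‖ ^ 2 = ∑ i : Fin 2, (fderiv ℝ u y (EuclideanSpace.single i 1)) ^ 2 := by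
  rw [EuclideanSpace.norm_sq_eq]
  refine Finset.sum_congr rfl fun i _ => ?_
  have h : fderiv ℝ u y (EuclideanSpace.single i 1) = gradient u y i := by
    have h1 : ⟪gradient u y, EuclideanSpace.single i (1 : ℝ)⟫
        = fderiv ℝ u y (EuclideanSpace.single i 1) := by
      simp [gradient]
    rw [← h1, EuclideanSpace.inner_single_right]
    simp
  rw [h, Real.norm_eq_abs, sq_abs]

lemma lapl_comp {H : ℝ → ℝ} {u : E2 → ℝ} {y : E2} (hH : ContDiffAt ℝ 2 H (u y))
    (hu : ContDiffAt ℝ 2 u y) :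
    lapl (fun z => H (u z)) y
      = deriv H (u y) * lapl u y - deriv (deriv H) (u y) * ‖gradient u y‖ ^ 2 := by
  have hHu : ContDiffAt ℝ 2 (fun z => H (u z)) y := hH.comp y hu
  rw [lapl_eq_neg_sum hHu, lapl_eq_neg_sum hu, norm_gradient_sq, mul_neg, ← neg_add',
    Finset.mul_sum, Finset.mul_sum, ← Finset.sum_add_distrib]
  congr 1
  refine Finset.sum_congr rfl fun i _ => ?_
  set e : E2 := EuclideanSpace.single i 1
  have hev : (fun z => fderiv ℝ (fun z => H (u z)) z e)
      =ᶠ[𝓝 y] fun z => deriv H (u z) * fderiv ℝ u z e := by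
    have h1 := hH.eventually (by simp)
    have h2 := hu.eventually (by simp)
    filter_upwards [hu.continuousAt.eventually h1, h2] with z hz1 hz2
    have d1 := (hz1.differentiableAt (by norm_num)).hasDerivAt
    have d2 := (hz2.differentiableAt (by norm_num)).hasFDerivAt
    have := (d1.comp_hasFDerivAt z d2).fderiv
    simp only [Function.comp_def] at this
    rw [this]
    simp
  rw [hev.fderiv_eq]
  have d1 : HasFDerivAt (fun z => deriv H (u z)) (deriv (deriv H) (u y) • fderiv ℝ u y) y := by
    have hd : DifferentiableAt ℝ (deriv H) (u y) := by
      have h3 : DifferentiableAt ℝ (fun t => fderiv ℝ H t 1) (u y) :=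
        ((hH.fderiv_right (m := 1) (by norm_num)).differentiableAt (by norm_num)).clm_apply
          (differentiableAt_const 1)
      exact h3
    exact hd.hasDerivAt.comp_hasFDerivAt y (hu.differentiableAt (by norm_num)).hasFDerivAt
  have d2 : DifferentiableAt ℝ (fun z => fderiv ℝ u z e) y :=
    ((hu.fderiv_right (m := 1) (by norm_num)).differentiableAt (by norm_num)).clm_apply
      (differentiableAt_const e)
  rw [HasFDerivAt.fderiv (d1.fun_mul d2.hasFDerivAt)]
  simp
  ring

lemma integral_mul_fderiv_fderiv {w ψ : E2 → ℝ} (hw : ContDiff ℝ 2 w) (hwc : HasCompactSupport w)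
    (hψ : ContDiff ℝ 2 ψ) (e : E2) :
    ∫ y, w y * fderiv ℝ (fun z => fderiv ℝ ψ z e) y e
      = ∫ y, fderiv ℝ (fun z => fderiv ℝ w z e) y e * ψ y := by
  have hw1 : ContDiff ℝ 1 (fun z => fderiv ℝ w z e) :=
    (hw.fderiv_right (m := 1) (by norm_num)).clm_apply contDiff_const
  have hψ1 : ContDiff ℝ 1 (fun z => fderiv ℝ ψ z e) :=
    (hψ.fderiv_right (m := 1) (by norm_num)).clm_apply contDiff_const
  have hw2 : Continuous (fun z => fderiv ℝ (fun z => fderiv ℝ w z e) z e) :=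
    (hw1.continuous_fderiv (by norm_num)).clm_apply continuous_const
  have hψ2 : Continuous (fun z => fderiv ℝ (fun z => fderiv ℝ ψ z e) z e) :=
    (hψ1.continuous_fderiv (by norm_num)).clm_apply continuous_const
  have hw1c : HasCompactSupport (fun z => fderiv ℝ w z e) := hwc.fderiv_apply ℝ e
  have hw2c : HasCompactSupport (fun z => fderiv ℝ (fun z => fderiv ℝ w z e) z e) :=
    hw1c.fderiv_apply ℝ e
  rw [integral_mul_fderiv_eq_neg_fderiv_mul_of_integrable,
    integral_mul_fderiv_eq_neg_fderiv_mul_of_integrable, neg_neg]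
  · exact (hw2.mul hψ.continuous).integrable_of_hasCompactSupport hw2c.mul_right
  · exact (hw1.continuous.mul hψ1.continuous).integrable_of_hasCompactSupport hw1c.mul_right
  · exact (hw1.continuous.mul hψ.continuous).integrable_of_hasCompactSupport hw1c.mul_right
  · exact fun x _ => hw1.differentiable (by norm_num) x
  · exact fun x _ => hψ.differentiable (by norm_num) x
  · exact (hw1.continuous.mul hψ1.continuous).integrable_of_hasCompactSupport hw1c.mul_right
  · exact (hw.continuous.mul hψ2).integrable_of_hasCompactSupport hwc.mul_right
  · exact (hw.continuous.mul hψ1.continuous).integrable_of_hasCompactSupport hwc.mul_right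
  · exact fun x _ => hw.differentiable (by norm_num) x
  · exact fun x _ => hψ1.differentiable (by norm_num) x

/-- Green's second identity on the whole plane. -/
lemma integral_mul_lapl {w ψ : E2 → ℝ} (hw : ContDiff ℝ 2 w) (hwc : HasCompactSupport w)
    (hψ : ContDiff ℝ 2 ψ) :
    ∫ y, w y * lapl ψ y = ∫ y, lapl w y * ψ y := by
  have hcont : ∀ {g : E2 → ℝ}, ContDiff ℝ 2 g → ∀ e : E2,
      Continuous (fun z => fderiv ℝ (fun z => fderiv ℝ g z e) z e) := fun hg e =>
    (((hg.fderiv_right (m := 1) (by norm_num)).clm_apply contDiff_const).continuous_fderiv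
      (by norm_num)).clm_apply continuous_const
  simp only [fun y => lapl_eq_neg_sum (y := y) hψ.contDiffAt,
    fun y => lapl_eq_neg_sum (y := y) hw.contDiffAt, mul_neg, neg_mul, MeasureTheory.integral_neg,
    Finset.mul_sum, Finset.sum_mul]
  rw [MeasureTheory.integral_finsetSum, MeasureTheory.integral_finsetSum]
  · simp only [integral_mul_fderiv_fderiv hw hwc hψ]
  · exact fun i _ => ((hcont hw _).mul hψ.continuous).integrable_of_hasCompactSupport
      ((hwc.fderiv_apply ℝ _).fderiv_apply ℝ _).mul_right
  · exact fun i _ => (hw.continuous.mul (hcont hψ _)).integrable_of_hasCompactSupport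
      hwc.mul_right

lemma continuous_lapl {w : E2 → ℝ} (hw : ContDiff ℝ 2 w) : Continuous (lapl w) := by
  have h1 : Continuous fun y => -∑ i : Fin 2, fderiv ℝ
      (fun z => fderiv ℝ w z (EuclideanSpace.single i 1)) y (EuclideanSpace.single i 1) :=
    (continuous_finsetSum _ fun i _ =>
      (((hw.fderiv_right (m := 1) (by norm_num)).clm_apply contDiff_const).continuous_fderiv
        (by norm_num)).clm_apply continuous_const).neg
  exact h1.congr fun y => (lapl_eq_neg_sum hw.contDiffAt).symm

/-- Superpositions `H ∘ u` with `H` vanishing near zero extend smoothly by zero. -/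
lemma contDiff_indicator_comp {Ω : Set E2} (hΩo : IsOpen Ω) (hΩb : IsBounded Ω) {u : E2 → ℝ}
    (hsm : ContDiffOn ℝ 2 u Ω) (hct : ContinuousOn u (closure Ω))
    (hbd : ∀ y ∈ frontier Ω, u y = 0) {H : ℝ → ℝ} (hH : ContDiff ℝ 2 H) {ε : ℝ} (hε : 0 < ε)
    (hH0 : ∀ t ≤ ε, H t = 0) :
    ContDiff ℝ 2 (Ω.indicator fun y => H (u y)) ∧
      HasCompactSupport (Ω.indicator fun y => H (u y)) ∧
      ∀ y ∉ Ω, Ω.indicator (fun y => H (u y)) =ᶠ[𝓝 y] fun _ => 0 := by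
  have hKc : IsCompact (closure Ω ∩ u ⁻¹' Set.Ici ε) :=
    hΩb.isCompact_closure.of_isClosed_subset
      (hct.preimage_isClosed_of_isClosed isClosed_closure isClosed_Ici) Set.inter_subset_left
  set K := closure Ω ∩ u ⁻¹' Set.Ici ε
  have hzero : ∀ y ∉ K, Ω.indicator (fun y => H (u y)) y = 0 := by
    intro y hy
    by_cases hyΩ : y ∈ Ω
    · rw [Set.indicator_of_mem hyΩ]
      refine hH0 _ ?_
      by_contra hlt
      exact hy ⟨subset_closure hyΩ, (not_le.1 hlt).le⟩
    · exact Set.indicator_of_notMem hyΩ _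
  have hKΩ : K ⊆ Ω := by
    rintro y ⟨hy1, hy2⟩
    by_contra hyΩ
    have hfr : u y = 0 := hbd y (by rw [hΩo.frontier_eq]; exact ⟨hy1, hyΩ⟩)
    have : ε ≤ u y := hy2
    linarith
  have hout : ∀ y ∉ Ω, Ω.indicator (fun y => H (u y)) =ᶠ[𝓝 y] fun _ => 0 := by
    intro y hy
    filter_upwards [hKc.isClosed.isOpen_compl.mem_nhds fun h => hy (hKΩ h)] with z hz
    exact hzero z hz
  refine ⟨contDiff_iff_contDiffAt.2 fun y => ?_, HasCompactSupport.intro hKc hzero, hout⟩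
  by_cases hy : y ∈ Ω
  · have h1 : ContDiffAt ℝ 2 (fun z => H (u z)) y :=
      hH.contDiffAt.comp y (hsm.contDiffAt (hΩo.mem_nhds hy))
    refine h1.congr_of_eventuallyEq ?_
    filter_upwards [hΩo.mem_nhds hy] with z hz
    exact Set.indicator_of_mem hz _
  · exact contDiffAt_const.congr_of_eventuallyEq (hout y hy)

/-- Green's identity for `H ∘ u` against a test function on `Ω`, without boundary terms. -/
lemma setIntegral_comp_mul_lapl {Ω : Set E2} (hΩo : IsOpen Ω) (hΩb : IsBounded Ω) {u : E2 → ℝ}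
    (hsm : ContDiffOn ℝ 2 u Ω) (hct : ContinuousOn u (closure Ω))
    (hbd : ∀ y ∈ frontier Ω, u y = 0) {H : ℝ → ℝ} (hH : ContDiff ℝ 2 H) {ε : ℝ} (hε : 0 < ε)
    (hH0 : ∀ t ≤ ε, H t = 0) {ψ : E2 → ℝ} (hψ : ContDiff ℝ 2 ψ) :
    IntegrableOn (fun y => (deriv H (u y) * lapl u y
      - deriv (deriv H) (u y) * ‖gradient u y‖ ^ 2) * ψ y) Ω ∧
    ∫ y in Ω, H (u y) * lapl ψ y = ∫ y in Ω, (deriv H (u y) * lapl u y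
      - deriv (deriv H) (u y) * ‖gradient u y‖ ^ 2) * ψ y := by
  obtain ⟨hw, hwc, hout⟩ := contDiff_indicator_comp hΩo hΩb hsm hct hbd hH hε hH0
  set w := Ω.indicator fun y => H (u y) with hwdef
  have hin : ∀ y ∈ Ω, lapl w y = deriv H (u y) * lapl u y
      - deriv (deriv H) (u y) * ‖gradient u y‖ ^ 2 := by
    intro y hy
    rw [← lapl_comp hH.contDiffAt (hsm.contDiffAt (hΩo.mem_nhds hy))]
    refine lapl_congr ?_
    filter_upwards [hΩo.mem_nhds hy] with z hz
    exact Set.indicator_of_mem hz _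
  have hlout : ∀ y ∉ Ω, lapl w y = 0 := by
    intro y hy
    rw [lapl_congr (hout y hy), lapl_eq_neg_sum contDiffAt_const]
    simp
  have hlw : Continuous (lapl w) := continuous_lapl hw
  have hlwc : HasCompactSupport (lapl w) := by
    refine HasCompactSupport.intro hwc fun y hy => ?_
    have : w =ᶠ[𝓝 y] fun _ => 0 := notMem_tsupport_iff_eventuallyEq.1 hy
    rw [lapl_congr this, lapl_eq_neg_sum contDiffAt_const]
    simp
  have hint : Integrable (fun y => lapl w y * ψ y) :=
    (hlw.mul hψ.continuous).integrable_of_hasCompactSupport hlwc.mul_right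
  have hcongr : Set.EqOn (fun y => lapl w y * ψ y) (fun y => (deriv H (u y) * lapl u y
      - deriv (deriv H) (u y) * ‖gradient u y‖ ^ 2) * ψ y) Ω := fun y hy => by
    simp only [hin y hy]
  refine ⟨(integrableOn_congr_fun hcongr hΩo.measurableSet).1 hint.integrableOn, ?_⟩
  rw [← setIntegral_congr_fun hΩo.measurableSet hcongr]
  have h1 : ∫ y in Ω, H (u y) * lapl ψ y = ∫ y, w y * lapl ψ y := by
    rw [← MeasureTheory.integral_indicator hΩo.measurableSet]
    congr 1
    ext y
    rw [hwdef]
    by_cases hy : y ∈ Ω <;> simp [hy]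
  rw [h1, integral_mul_lapl hw hwc hψ]
  refine (setIntegral_eq_integral_of_forall_compl_eq_zero fun y hy => ?_).symm
  rw [hlout y hy, zero_mul]

lemma deriv_primitive {h : ℝ → ℝ} (hh : Continuous h) :
    deriv (fun t => ∫ s in (0 : ℝ)..t, h s) = h :=
  funext fun t => hh.deriv_integral h 0 t

lemma contDiff_primitive {h : ℝ → ℝ} {n : ℕ} (hh : ContDiff ℝ n h) :
    ContDiff ℝ (n + 1 : ℕ) (fun t => ∫ s in (0 : ℝ)..t, h s) := by
  have hd : Differentiable ℝ (fun t => ∫ s in (0 : ℝ)..t, h s) := fun t =>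
    (hh.continuous.integral_hasStrictDerivAt 0 t).hasDerivAt.differentiableAt
  push_cast
  rw [contDiff_succ_iff_deriv]
  refine ⟨hd, by simp, ?_⟩
  rwa [deriv_primitive hh.continuous]

lemma primitive_eq_zero {h : ℝ → ℝ} {ε : ℝ} (hε : 0 < ε) (h0 : ∀ t ≤ ε, h t = 0) :
    ∀ t ≤ ε, ∫ s in (0 : ℝ)..t, h s = 0 := by
  intro t ht
  refine intervalIntegral.integral_zero_ae (Eventually.of_forall fun s hs => h0 s ?_)
  rcases Set.mem_uIoc.1 hs with h | h
  · exact h.2.trans ht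
  · exact h.2.trans hε.le

/-- A smooth convex approximation of the positive part, vanishing near zero. -/
lemma exists_smooth_truncation {ε : ℝ} (hε : 0 < ε) :
    ∃ Φ : ℝ → ℝ, ContDiff ℝ 2 Φ ∧ (∀ t ≤ ε, Φ t = 0) ∧ (∀ t, 0 ≤ deriv Φ t) ∧
      (∀ t, deriv Φ t ≤ 1) ∧ (∀ t, 0 ≤ deriv (deriv Φ) t) ∧ ∀ t, t - 2 * ε ≤ Φ t := by
  set h : ℝ → ℝ := fun t => Real.smoothTransition (t / ε - 1)
  have hh : ContDiff ℝ (1 : ℕ) h :=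
    Real.smoothTransition.contDiff.comp ((contDiff_id.div_const ε).sub contDiff_const)
  have hmono : Monotone h := fun s t hst => Real.smoothTransition.monotone (by gcongr)
  have h0 : ∀ t ≤ ε, h t = 0 := fun t ht =>
    Real.smoothTransition.zero_of_nonpos (by rw [sub_nonpos, div_le_one hε]; exact ht)
  have h1 : ∀ t, 2 * ε ≤ t → h t = 1 := fun t ht =>
    Real.smoothTransition.one_of_one_le (by
      rw [le_sub_iff_add_le, le_div_iff₀ hε]; linarith)
  have hii : ∀ s t, IntervalIntegrable h volume s t := fun s t =>
    hh.continuous.intervalIntegrable s t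
  have hnn : ∀ t, 0 ≤ h t := fun t => Real.smoothTransition.nonneg _
  refine ⟨fun t => ∫ s in (0 : ℝ)..t, h s, contDiff_primitive hh, primitive_eq_zero hε h0, ?_⟩
  rw [deriv_primitive hh.continuous]
  refine ⟨hnn, fun t => Real.smoothTransition.le_one _, fun t => hmono.deriv_nonneg, ?_⟩
  intro t
  simp only
  rcases le_total t 0 with ht | ht
  · rw [primitive_eq_zero hε h0 t (ht.trans hε.le)]
    linarith
  · rcases le_total t (2 * ε) with ht2 | ht2
    · have := intervalIntegral.integral_nonneg (μ := volume) ht fun s _ => hnn s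
      linarith
    · rw [← intervalIntegral.integral_add_adjacent_intervals (hii 0 (2 * ε)) (hii (2 * ε) t)]
      have e1 : ∫ s in (2 * ε)..t, h s = ∫ s in (2 * ε)..t, (1 : ℝ) := by
        refine intervalIntegral.integral_congr fun s hs => h1 s ?_
        rw [Set.uIcc_of_le ht2] at hs
        exact hs.1
      have e2 := intervalIntegral.integral_nonneg (μ := volume)
        (by linarith : (0 : ℝ) ≤ 2 * ε) fun s _ => hnn s
      rw [e1]
      simp
      linarith

lemma le_of_forall_pos_le_add_mul {a b c : ℝ} (hc : 0 ≤ c) (h : ∀ ε > 0, a ≤ b + ε * c) :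
    a ≤ b := by
  refine le_of_forall_pos_le_add fun δ hδ => (h (δ / (c + 1)) (by positivity)).trans ?_
  gcongr
  rw [div_mul_eq_mul_div, div_le_iff₀ (by positivity)]
  nlinarith

lemma ContinuousOn.integrableOn_of_isBounded {Ω : Set E2} (hΩb : IsBounded Ω) {g : E2 → ℝ}
    (hg : ContinuousOn g (closure Ω)) : IntegrableOn g Ω :=
  (hg.integrableOn_compact hΩb.isCompact_closure).mono_set subset_closure

/-- The energy controls `∫ u · lapl u`. -/
lemma setIntegral_mul_lapl_le_energy {Ω : Set E2} (hΩo : IsOpen Ω) (hΩb : IsBounded Ω)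
    {u f : E2 → ℝ} (hsm : ContDiffOn ℝ 2 u Ω) (hct : ContinuousOn u (closure Ω))
    (hbd : ∀ y ∈ frontier Ω, u y = 0) (hf : ContinuousOn f (closure Ω))
    (hf0 : ∀ y ∈ Ω, 0 ≤ f y) (hpde : ∀ y ∈ Ω, lapl u y = f y)
    (hgint : IntegrableOn (fun y => ‖gradient u y‖ ^ 2) Ω) :
    ∫ y in Ω, u y * f y ≤ ∫ y in Ω, ‖gradient u y‖ ^ 2 := by
  have hfi : IntegrableOn f Ω := hf.integrableOn_of_isBounded hΩb
  have hufi : IntegrableOn (fun y => u y * f y) Ω :=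
    (hct.mul hf).integrableOn_of_isBounded hΩb
  refine le_of_forall_pos_le_add_mul (c := 2 * ∫ y in Ω, f y)
    (mul_nonneg zero_le_two (setIntegral_nonneg hΩo.measurableSet hf0)) fun ε hε => ?_
  obtain ⟨Φ, hΦ, hΦ0, -, hΦ1, -, hΦlow⟩ := exists_smooth_truncation hε
  set Ψ : ℝ → ℝ := fun t => ∫ s in (0 : ℝ)..t, Φ s
  have hΨ : ContDiff ℝ 2 Ψ := (contDiff_primitive (n := 2) hΦ).of_le (by norm_num)
  have hΨd : deriv Ψ = Φ := deriv_primitive hΦ.continuous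
  obtain ⟨hi, he⟩ := setIntegral_comp_mul_lapl hΩo hΩb hsm hct hbd hΨ hε
    (primitive_eq_zero hε hΦ0) (ψ := fun _ => 1) contDiff_const
  have hlap1 : ∀ y : E2, lapl (fun _ => (1 : ℝ)) y = 0 := fun y => by
    rw [lapl_eq_neg_sum contDiffAt_const]; simp
  simp only [hlap1, mul_zero, MeasureTheory.integral_zero, mul_one, hΨd] at hi he
  have hΦf : IntegrableOn (fun y => Φ (u y) * f y) Ω :=
    ((hΦ.continuous.comp_continuousOn hct).mul hf).integrableOn_of_isBounded hΩb
  have h1 : ∫ y in Ω, Φ (u y) * f y ≤ ∫ y in Ω, ‖gradient u y‖ ^ 2 := by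
    have h2 : ∫ y in Ω, Φ (u y) * f y
        ≤ ∫ y in Ω, (Φ (u y) * lapl u y - deriv Φ (u y) * ‖gradient u y‖ ^ 2)
          + ‖gradient u y‖ ^ 2 := by
      refine setIntegral_mono_on hΦf (hi.add hgint) hΩo.measurableSet fun y hy => ?_
      rw [hpde y hy]
      nlinarith [hΦ1 (u y), sq_nonneg ‖gradient u y‖]
    rw [MeasureTheory.integral_add hi hgint, ← he, zero_add] at h2
    exact h2
  have h3 : ∫ y in Ω, u y * f y ≤ ∫ y in Ω, (Φ (u y) * f y + ε * 2 * f y) := by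
    refine setIntegral_mono_on hufi (hΦf.add (hfi.const_mul _)) hΩo.measurableSet fun y hy => ?_
    nlinarith [hΦlow (u y), hf0 y hy]
  rw [MeasureTheory.integral_add hΦf (hfi.const_mul _), MeasureTheory.integral_const_mul] at h3
  linarith

/-- Kato's inequality: the extension of `u` by zero is a subsolution on the whole plane. -/
lemma setIntegral_mul_lapl_le {Ω : Set E2} (hΩo : IsOpen Ω) (hΩb : IsBounded Ω)
    {u f : E2 → ℝ} (hsm : ContDiffOn ℝ 2 u Ω) (hct : ContinuousOn u (closure Ω))
    (hbd : ∀ y ∈ frontier Ω, u y = 0) (hf : ContinuousOn f (closure Ω))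
    (hf0 : ∀ y ∈ Ω, 0 ≤ f y) (hpde : ∀ y ∈ Ω, lapl u y = f y)
    {ψ : E2 → ℝ} (hψ : ContDiff ℝ 2 ψ) (hψ0 : ∀ y ∈ Ω, 0 ≤ ψ y)
    (hlψ0 : ∀ y ∈ Ω, 0 ≤ lapl ψ y) :
    ∫ y in Ω, u y * lapl ψ y ≤ ∫ y in Ω, f y * ψ y := by
  have hl : ContinuousOn (lapl ψ) (closure Ω) := (continuous_lapl hψ).continuousOn
  have hli : IntegrableOn (lapl ψ) Ω := hl.integrableOn_of_isBounded hΩb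
  refine le_of_forall_pos_le_add_mul (c := 2 * ∫ y in Ω, lapl ψ y)
    (mul_nonneg zero_le_two (setIntegral_nonneg hΩo.measurableSet hlψ0)) fun ε hε => ?_
  obtain ⟨Φ, hΦ, hΦ0, hΦnn, hΦ1, hΦ2, hΦlow⟩ := exists_smooth_truncation hε
  obtain ⟨hi, he⟩ := setIntegral_comp_mul_lapl hΩo hΩb hsm hct hbd hΦ hε hΦ0 hψ
  have hΦl : IntegrableOn (fun y => Φ (u y) * lapl ψ y) Ω :=
    ((hΦ.continuous.comp_continuousOn hct).mul hl).integrableOn_of_isBounded hΩb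
  have h1 : ∫ y in Ω, Φ (u y) * lapl ψ y ≤ ∫ y in Ω, f y * ψ y := by
    rw [he]
    refine setIntegral_mono_on hi ((hf.mul hψ.continuous.continuousOn).integrableOn_of_isBounded
      hΩb) hΩo.measurableSet fun y hy => ?_
    rw [hpde y hy]
    refine mul_le_mul_of_nonneg_right ?_ (hψ0 y hy)
    nlinarith [hΦ1 (u y), hf0 y hy, mul_nonneg (hΦ2 (u y)) (sq_nonneg ‖gradient u y‖)]
  have h3 : ∫ y in Ω, u y * lapl ψ y
      ≤ ∫ y in Ω, (Φ (u y) * lapl ψ y + ε * 2 * lapl ψ y) := by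
    refine setIntegral_mono_on ((hct.mul hl).integrableOn_of_isBounded hΩb)
      (hΦl.add (hli.const_mul _)) hΩo.measurableSet fun y hy => ?_
    nlinarith [hΦlow (u y), hlψ0 y hy]
  rw [MeasureTheory.integral_add hΦl (hli.const_mul _), MeasureTheory.integral_const_mul] at h3
  linarith

/-- The regularised logarithmic potential centred at `x`. -/
def logPotential (Q δ : ℝ) (x y : E2) : ℝ := 2⁻¹ * (Real.log Q - Real.log (‖y - x‖ ^ 2 + δ ^ 2))

lemma contDiff_norm_sub_sq_add (x : E2) (δ : ℝ) :
    ContDiff ℝ 2 (fun y : E2 => ‖y - x‖ ^ 2 + δ ^ 2) :=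
  ((contDiff_id.sub contDiff_const).norm_sq ℝ).add contDiff_const

lemma contDiff_logPotential (Q : ℝ) {δ : ℝ} (hδ : 0 < δ) (x : E2) :
    ContDiff ℝ 2 (logPotential Q δ x) :=
  contDiff_const.mul (contDiff_const.sub
    ((contDiff_norm_sub_sq_add x δ).log fun y => by positivity))

lemma fderiv_norm_sub_sq_add (x y e : E2) (δ : ℝ) :
    fderiv ℝ (fun y : E2 => ‖y - x‖ ^ 2 + δ ^ 2) y e = 2 * ⟪y - x, e⟫ := by
  have h := (((hasFDerivAt_id y).sub_const x).norm_sq).add_const (δ ^ 2)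
  simp only [id] at h
  rw [h.fderiv]
  simp [inner_sub_left]

lemma lapl_norm_sub_sq_add (x y : E2) (δ : ℝ) :
    lapl (fun y : E2 => ‖y - x‖ ^ 2 + δ ^ 2) y = -4 := by
  rw [lapl_eq_neg_sum (contDiff_norm_sub_sq_add x δ).contDiffAt]
  simp only [fderiv_norm_sub_sq_add]
  have h : ∀ e : E2, ‖e‖ = 1 → fderiv ℝ (fun z : E2 => 2 * ⟪z - x, e⟫) y e = 2 := by
    intro e he
    have h := (((hasFDerivAt_id y).sub_const x).inner ℝ (hasFDerivAt_const e y)).const_mul 2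
    simp only [id] at h
    rw [h.fderiv]
    simp [he]
  simp only [h _ (show ‖(EuclideanSpace.single _ 1 : E2)‖ = 1 by simp)]
  norm_num

lemma norm_gradient_norm_sub_sq_add (x y : E2) (δ : ℝ) :
    ‖gradient (fun y : E2 => ‖y - x‖ ^ 2 + δ ^ 2) y‖ ^ 2 = 4 * ‖y - x‖ ^ 2 := by
  rw [norm_gradient_sq, EuclideanSpace.norm_sq_eq]
  simp only [fderiv_norm_sub_sq_add, EuclideanSpace.inner_single_right, Finset.mul_sum]
  refine Finset.sum_congr rfl fun i _ => ?_
  simp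
  ring

lemma lapl_logPotential (Q : ℝ) {δ : ℝ} (hδ : 0 < δ) (x y : E2) :
    lapl (logPotential Q δ x) y = 2 * (δ ^ 2 / (‖y - x‖ ^ 2 + δ ^ 2) ^ 2) := by
  have hs : 0 < ‖y - x‖ ^ 2 + δ ^ 2 := by positivity
  have hd : ∀ t : ℝ, deriv (fun s => 2⁻¹ * (Real.log Q - Real.log s)) t = -2⁻¹ * t⁻¹ := by
    intro t
    simp
  have hd2 : deriv (deriv (fun s => 2⁻¹ * (Real.log Q - Real.log s))) (‖y - x‖ ^ 2 + δ ^ 2)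
      = 2⁻¹ * ((‖y - x‖ ^ 2 + δ ^ 2) ^ 2)⁻¹ := by
    rw [funext hd]
    simp
  have := lapl_comp (H := fun s => 2⁻¹ * (Real.log Q - Real.log s))
    (contDiffAt_const.mul (contDiffAt_const.sub (Real.contDiffAt_log.2 hs.ne')))
    (contDiff_norm_sub_sq_add x δ).contDiffAt (y := y)
  unfold logPotential
  rw [this, hd, hd2, lapl_norm_sub_sq_add, norm_gradient_norm_sub_sq_add]
  field_simp
  ring

lemma integral_inv_one_add_norm_sq_sq :
    ∫ z : E2, Real.pi⁻¹ * ((1 + ‖z‖ ^ 2) ^ 2)⁻¹ = 1 := by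
  rw [integral_fun_norm_addHaar volume (fun r : ℝ => Real.pi⁻¹ * ((1 + r ^ 2) ^ 2)⁻¹)]
  have hball : (volume : Measure E2).real (ball 0 1) = Real.pi := by
    rw [Measure.real, EuclideanSpace.volume_ball_fin_two]
    simp [Real.pi_nonneg]
  have hint : ∫ y in Set.Ioi (0 : ℝ), y * (Real.pi⁻¹ * ((1 + y ^ 2) ^ 2)⁻¹)
      = 0 - -(2 * Real.pi)⁻¹ * (1 + (0 : ℝ) ^ 2)⁻¹ := by
    refine integral_Ioi_of_hasDerivAt_of_nonneg' (g := fun y => -(2 * Real.pi)⁻¹ * (1 + y ^ 2)⁻¹)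
      (fun y _ => ?_) (fun y hy => ?_) ?_
    · have h : HasDerivAt (fun y : ℝ => 1 + y ^ 2) (2 * y) y := by
        simpa using (hasDerivAt_pow 2 y).const_add 1
      refine ((h.fun_inv (by positivity)).const_mul (-(2 * Real.pi)⁻¹)).congr_deriv ?_
      field_simp
    · have : 0 < y := hy
      positivity
    · have h : Tendsto (fun y : ℝ => 1 + y ^ 2) atTop atTop :=
        tendsto_atTop_add_const_left _ _ (tendsto_pow_atTop two_ne_zero)
      simpa using (tendsto_inv_atTop_zero.comp h).const_mul (-(2 * Real.pi)⁻¹)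
  rw [hball]
  simp only [finrank_euclideanSpace, Fintype.card_fin, Nat.add_one_sub_one, pow_one, smul_eq_mul]
  rw [hint]
  have := Real.pi_ne_zero
  simp

lemma tendsto_norm_sq_mul_inv_one_add :
    Tendsto (fun z : E2 => ‖z‖ ^ Module.finrank ℝ E2 * (Real.pi⁻¹ * ((1 + ‖z‖ ^ 2) ^ 2)⁻¹))
      (cobounded E2) (𝓝 0) := by
  have h : Tendsto (fun z : E2 => 1 + ‖z‖ ^ 2) (cobounded E2) atTop :=
    tendsto_atTop_add_const_left _ _
      ((tendsto_pow_atTop two_ne_zero).comp tendsto_norm_cobounded_atTop)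
  have h2 : Tendsto (fun z : E2 => Real.pi⁻¹ * (1 + ‖z‖ ^ 2)⁻¹) (cobounded E2) (𝓝 0) := by
    simpa using (tendsto_inv_atTop_zero.comp h).const_mul Real.pi⁻¹
  refine squeeze_zero (fun z => by positivity) (fun z => ?_) h2
  have hpi := Real.pi_pos
  simp only [finrank_euclideanSpace, Fintype.card_fin]
  rw [mul_left_comm]
  gcongr
  rw [← div_eq_mul_inv, div_le_iff₀ (by positivity), sq (1 + ‖z‖ ^ 2), inv_mul_cancel_left₀
    (by positivity)]
  linarith

/-- Pointwise bound at `x` by uniform bounds for regularised averages around `x`. -/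
lemma two_pi_mul_le_of_forall_setIntegral_le {Ω : Set E2} (hΩo : IsOpen Ω) (hΩb : IsBounded Ω)
    {u : E2 → ℝ} (hct : ContinuousOn u (closure Ω)) {x : E2} (hx : x ∈ Ω) {Q M : ℝ}
    (hM : ∀ δ, 0 < δ → δ ≤ 1 → ∫ y in Ω, u y * lapl (logPotential Q δ x) y ≤ M) :
    2 * Real.pi * u x ≤ M := by
  have hgi : Integrable (Ω.indicator u) :=
    (integrable_indicator_iff hΩo.measurableSet).2 (hct.integrableOn_of_isBounded hΩb)
  have hgc : ContinuousAt (Ω.indicator u) x := by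
    have h1 : ContinuousAt u x :=
      (hct.mono subset_closure).continuousAt (hΩo.mem_nhds hx)
    refine h1.congr ?_
    filter_upwards [hΩo.mem_nhds hx] with z hz
    exact (Set.indicator_of_mem hz _).symm
  have ht := tendsto_integral_comp_smul_smul_of_integrable' (μ := (volume : Measure E2))
    (φ := fun z => Real.pi⁻¹ * ((1 + ‖z‖ ^ 2) ^ 2)⁻¹) (fun z => by positivity)
    integral_inv_one_add_norm_sq_sq tendsto_norm_sq_mul_inv_one_add hgi hgc
  rw [Set.indicator_of_mem hx] at ht
  refine le_of_tendsto (ht.const_mul (2 * Real.pi)) ?_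
  filter_upwards [eventually_ge_atTop (1 : ℝ)] with c hc
  have hc0 : 0 < c := by linarith
  refine le_trans (le_of_eq ?_) (hM c⁻¹ (by positivity) (inv_le_one_of_one_le₀ hc))
  rw [← MeasureTheory.integral_const_mul, ← MeasureTheory.integral_indicator hΩo.measurableSet]
  congr 1
  ext y
  by_cases hy : y ∈ Ω
  · rw [Set.indicator_of_mem hy, Set.indicator_of_mem hy, lapl_logPotential Q (by positivity)]
    simp only [finrank_euclideanSpace, Fintype.card_fin, smul_eq_mul, norm_smul,
      Real.norm_eq_abs, mul_pow, sq_abs, norm_sub_rev x y]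
    have := Real.pi_ne_zero
    field_simp
    ring
  · simp [hy]

lemma integrableOn_ball_norm_rpow {θ : ℝ} (hθ : θ < 1) (d : ℝ) :
    IntegrableOn (fun z : E2 => ‖z‖ ^ (-(2 * θ))) (ball 0 d) := by
  refine integrableOn_ball_of_norm_le_rpow (C := 1) (α := 2 * θ) (by simp) ?_ ?_ ?_
  · simp
    linarith
  · refine Eventually.of_forall fun z => ?_
    rw [one_mul, Real.norm_of_nonneg (by positivity)]
  · exact (by fun_prop : Measurable fun z : E2 => ‖z‖ ^ (-(2 * θ))).aestronglyMeasurable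

/-- Subcritical exponentials of logarithmic potentials are uniformly integrable over bounded
sets. -/
lemma exists_setIntegral_exp_logPotential_le {θ : ℝ} (hθ0 : 0 < θ) (hθ : θ < 1) (Q d : ℝ) :
    ∃ C, ∀ (Ω : Set E2) (x : E2) (δ : ℝ), IsOpen Ω → 0 < δ → Ω ⊆ ball x d →
      ∫ y in Ω, Real.exp (2 * θ * logPotential Q δ x y) ≤ C := by
  set G : E2 → ℝ := (ball 0 d).indicator fun z => Real.exp (θ * Real.log Q) * ‖z‖ ^ (-(2 * θ))
    with hG
  have hGi : Integrable G :=
    (integrable_indicator_iff measurableSet_ball).2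
      ((integrableOn_ball_norm_rpow hθ d).const_mul _)
  have hG0 : ∀ z, 0 ≤ G z := fun z => Set.indicator_nonneg (fun z _ => by positivity) z
  refine ⟨∫ z, G z, fun Ω x δ hΩo hδ hΩ => ?_⟩
  have hGxi : Integrable (fun y => G (y - x)) := hGi.comp_sub_right x
  have hbdd : IsBounded Ω := isBounded_ball.subset hΩ
  have hcont : Continuous fun y => Real.exp (2 * θ * logPotential Q δ x y) :=
    (continuous_const.mul (contDiff_logPotential Q hδ x).continuous).rexp
  calc ∫ y in Ω, Real.exp (2 * θ * logPotential Q δ x y) ≤ ∫ y in Ω, G (y - x) := by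
        refine setIntegral_mono_on_ae
          (hcont.continuousOn.integrableOn_of_isBounded hbdd)
          hGxi.integrableOn hΩo.measurableSet ?_
        filter_upwards [compl_mem_ae_iff.2 (measure_singleton x)] with y hyx hy
        have hne : 0 < ‖y - x‖ := norm_pos_iff.2 (sub_ne_zero.2 hyx)
        have hmem : y - x ∈ ball (0 : E2) d := by
          simpa [dist_eq_norm] using hΩ hy
        rw [hG, Set.indicator_of_mem hmem, Real.rpow_def_of_pos hne, ← Real.exp_add]
        refine Real.exp_le_exp.2 ?_
        have hlog : 2 * Real.log ‖y - x‖ ≤ Real.log (‖y - x‖ ^ 2 + δ ^ 2) := by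
          have h := Real.log_le_log (by positivity : 0 < ‖y - x‖ ^ 2)
            (by linarith [sq_nonneg δ] : ‖y - x‖ ^ 2 ≤ ‖y - x‖ ^ 2 + δ ^ 2)
          rwa [Real.log_pow, Nat.cast_ofNat] at h
        unfold logPotential
        nlinarith [mul_le_mul_of_nonneg_left hlog hθ0.le]
    _ ≤ ∫ y, G (y - x) := setIntegral_le_integral hGxi (Eventually.of_forall fun y => hG0 _)
    _ = ∫ z, G z := integral_sub_right_eq_self G x

lemma mul_le_mul_log_add_exp {b : ℝ} (hb : 0 < b) (t : ℝ) :
    b * t ≤ b * Real.log b + Real.exp t := by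
  have h1 := Real.add_one_le_exp (t - Real.log b)
  have h2 : Real.exp t = b * Real.exp (t - Real.log b) := by
    rw [Real.exp_sub, Real.exp_log hb]
    field_simp
  nlinarith [mul_le_mul_of_nonneg_left h1 hb.le]

lemma source_mul_le {a lam l s γ ε θ p : ℝ} (ha : 0 ≤ a) (hal : a ≤ lam) (hl : 0 < l) (hs : 0 < s)
    (hsγ : s ≤ γ) (hε : 0 ≤ ε) (hθ : 0 < θ) (hp : 0 ≤ p)
    (hlog : Real.log l ≤ -ε * γ ^ 2) (hε1 : ε ≤ 1) :
    s * (a + l * Real.exp (s ^ 2)) * p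
      ≤ (((1 - ε) * γ + 1) / (2 * θ) + 1 / 2) * (s * (s * (a + l * Real.exp (s ^ 2))))
        + (1 / (2 * θ) + lam / (2 * θ ^ 2)) * Real.exp (2 * θ * p) := by
  set b := l * s * Real.exp (s ^ 2) with hbdef
  have hb : 0 < b := by positivity
  have hlogb : Real.log b ≤ ((1 - ε) * γ + 1) * s := by
    have hlb : Real.log b = Real.log l + Real.log s + s ^ 2 := by
      rw [hbdef, Real.log_mul (by positivity) (by positivity), Real.log_mul hl.ne' hs.ne',
        Real.log_exp]
    have h1 : Real.log s ≤ s := (Real.log_le_sub_one_of_pos hs).trans (by linarith)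
    nlinarith [mul_nonneg (sub_nonneg.2 hsγ) (add_nonneg hs.le (mul_nonneg hε (hs.le.trans hsγ)))]
  have hyoung := mul_le_mul_log_add_exp hb (2 * θ * p)
  have hblog := mul_le_mul_of_nonneg_left hlogb hb.le
  have hk : 0 ≤ (1 - ε) * γ + 1 := by
    have := mul_nonneg (sub_nonneg.2 hε1) (hs.le.trans hsγ)
    linarith
  have hexp0 := Real.exp_pos (2 * θ * p)
  have h1 : b * p ≤ (((1 - ε) * γ + 1) / (2 * θ)) * (s * b)
      + 1 / (2 * θ) * Real.exp (2 * θ * p) := by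
    have : b * p = (2 * θ)⁻¹ * (b * (2 * θ * p)) := by field_simp
    rw [this]
    have h3 : (((1 - ε) * γ + 1) / (2 * θ)) * (s * b) + 1 / (2 * θ) * Real.exp (2 * θ * p)
        = (2 * θ)⁻¹ * (b * (((1 - ε) * γ + 1) * s) + Real.exp (2 * θ * p)) := by
      field_simp
    rw [h3]
    gcongr
    linarith
  have hsq : p ^ 2 ≤ Real.exp (2 * θ * p) / θ ^ 2 := by
    rw [le_div_iff₀ (by positivity)]
    have h4 : θ * p ≤ Real.exp (θ * p) := by linarith [Real.add_one_le_exp (θ * p)]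
    have h5 : Real.exp (2 * θ * p) = Real.exp (θ * p) ^ 2 := by
      rw [← Real.exp_nat_mul]
      congr 1
      push_cast
      ring
    rw [h5, ← mul_pow, mul_comm p θ]
    exact pow_le_pow_left₀ (by positivity) h4 2
  have h2 : a * s * p ≤ 1 / 2 * (a * s ^ 2) + lam / (2 * θ ^ 2) * Real.exp (2 * θ * p) := by
    have h6 : s * p ≤ s ^ 2 / 2 + p ^ 2 / 2 := by nlinarith [sq_nonneg (s - p)]
    have h7 : a * p ^ 2 ≤ lam * (Real.exp (2 * θ * p) / θ ^ 2) :=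
      mul_le_mul hal hsq (sq_nonneg p) (ha.trans hal)
    have h8 : lam / (2 * θ ^ 2) * Real.exp (2 * θ * p)
        = lam * (Real.exp (2 * θ * p) / θ ^ 2) / 2 := by
      field_simp
    rw [h8]
    nlinarith [mul_le_mul_of_nonneg_left h6 ha]
  have h9 : s * (a + l * Real.exp (s ^ 2)) = a * s + b := by rw [hbdef]; ring
  rw [h9]
  have h10 : 0 ≤ ((1 - ε) * γ + 1) / (2 * θ) * (a * s ^ 2) := by positivity
  have h11 : 0 ≤ s * b := by positivity
  linear_combination h1 + h2 + h10 + (1 / 2) * h11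

/-- A priori bound for the maximum of a solution whose exponential coefficient is at most
`exp (-ε γ ^ 2)`. -/
lemma two_pi_mul_le_of_log_le {Ω : Set E2} (hΩo : IsOpen Ω) {u : E2 → ℝ} {a l lam : ℝ}
    (ha : 0 ≤ a) (hal : a ≤ lam) (hl : 0 < l)
    (hsm : ContDiffOn ℝ 2 u Ω) (hct : ContinuousOn u (closure Ω)) (hpos : ∀ y ∈ Ω, 0 < u y)
    (hpde : ∀ y ∈ Ω, lapl u y = u y * (a + l * Real.exp (u y ^ 2)))
    (hbd : ∀ y ∈ frontier Ω, u y = 0)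
    (hgint : IntegrableOn (fun y => ‖gradient u y‖ ^ 2) Ω)
    {x : E2} (hx : x ∈ Ω) (hmax : ∀ y ∈ Ω, u y ≤ u x) {d : ℝ} (hΩd : Ω ⊆ ball x d)
    {ε θ C : ℝ} (hε : 0 ≤ ε) (hε1 : ε ≤ 1) (hθ : 0 < θ)
    (hlog : Real.log l ≤ -ε * u x ^ 2)
    (hC : ∀ δ, 0 < δ → ∫ y in Ω, Real.exp (2 * θ * logPotential (d ^ 2 + 1) δ x y) ≤ C) :
    2 * Real.pi * u x ≤ (((1 - ε) * u x + 1) / (2 * θ) + 1 / 2) * (∫ y in Ω, ‖gradient u y‖ ^ 2)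
      + (1 / (2 * θ) + lam / (2 * θ ^ 2)) * C := by
  have hΩb : IsBounded Ω := isBounded_ball.subset hΩd
  set f : E2 → ℝ := fun y => u y * (a + l * Real.exp (u y ^ 2))
  have hf : ContinuousOn f (closure Ω) := by fun_prop
  have hf0 : ∀ y ∈ Ω, 0 ≤ f y := fun y hy => by
    have := hpos y hy
    positivity
  refine two_pi_mul_le_of_forall_setIntegral_le hΩo hΩb hct hx (Q := d ^ 2 + 1)
    fun δ hδ hδ1 => ?_
  have hψ := contDiff_logPotential (d ^ 2 + 1) hδ x
  have hψ0 : ∀ y ∈ Ω, 0 ≤ logPotential (d ^ 2 + 1) δ x y := by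
    intro y hy
    have h1 : ‖y - x‖ < d := by simpa [dist_eq_norm] using hΩd hy
    have h2 : Real.log (‖y - x‖ ^ 2 + δ ^ 2) ≤ Real.log (d ^ 2 + 1) := by
      refine Real.log_le_log (by positivity) ?_
      nlinarith [norm_nonneg (y - x)]
    unfold logPotential
    linarith
  refine (setIntegral_mul_lapl_le hΩo hΩb hsm hct hbd hf hf0 hpde hψ hψ0 fun y _ => ?_).trans ?_
  · rw [lapl_logPotential _ hδ]
    positivity
  have huf : IntegrableOn (fun y => u y * f y) Ω := (hct.mul hf).integrableOn_of_isBounded hΩb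
  have hexp : IntegrableOn (fun y => Real.exp (2 * θ * logPotential (d ^ 2 + 1) δ x y)) Ω :=
    (continuous_const.mul hψ.continuous).rexp.continuousOn.integrableOn_of_isBounded hΩb
  have hen := setIntegral_mul_lapl_le_energy hΩo hΩb hsm hct hbd hf hf0 hpde hgint
  have hux := hpos x hx
  have hε' : 0 ≤ 1 - ε := sub_nonneg.2 hε1
  have hlam : 0 ≤ lam := ha.trans hal
  calc ∫ y in Ω, f y * logPotential (d ^ 2 + 1) δ x y
      ≤ ∫ y in Ω, ((((1 - ε) * u x + 1) / (2 * θ) + 1 / 2) * (u y * f y)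
        + (1 / (2 * θ) + lam / (2 * θ ^ 2))
          * Real.exp (2 * θ * logPotential (d ^ 2 + 1) δ x y)) := by
        refine setIntegral_mono_on
          ((hf.mul hψ.continuous.continuousOn).integrableOn_of_isBounded hΩb)
          ((huf.const_mul _).add (hexp.const_mul _)) hΩo.measurableSet fun y hy => ?_
        exact source_mul_le ha hal hl (hpos y hy) (hmax y hy) hε hθ (hψ0 y hy) hlog hε1
    _ = (((1 - ε) * u x + 1) / (2 * θ) + 1 / 2) * (∫ y in Ω, u y * f y)
        + (1 / (2 * θ) + lam / (2 * θ ^ 2))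
          * ∫ y in Ω, Real.exp (2 * θ * logPotential (d ^ 2 + 1) δ x y) := by
        rw [MeasureTheory.integral_add (huf.const_mul _) (hexp.const_mul _),
          MeasureTheory.integral_const_mul, MeasureTheory.integral_const_mul]
    _ ≤ _ := by
        have := hC δ hδ
        gcongr

lemma tendsto_log_div_sq_of_abs {L γ : ℕ → ℝ} (hL : ∀ᶠ n in atTop, L n < 0)
    (hγ : Tendsto γ atTop atTop) (h : Tendsto (fun n => |L n| / γ n ^ 2) atTop (𝓝 0)) :
    Tendsto (fun n => (L n - Real.log 4 + 2 * Real.log (γ n) + γ n ^ 2) / γ n ^ 2)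
      atTop (𝓝 1) := by
  have hsq : Tendsto (fun n => γ n ^ 2) atTop atTop :=
    (tendsto_pow_atTop two_ne_zero).comp hγ
  have h1 : Tendsto (fun n => Real.log (γ n) / γ n ^ 2) atTop (𝓝 0) := by
    have := (isLittleO_log_rpow_atTop (r := 2) two_pos).tendsto_div_nhds_zero.comp hγ
    simpa [Function.comp_def] using this
  have h2 : Tendsto (fun n => Real.log 4 / γ n ^ 2) atTop (𝓝 0) := hsq.const_div_atTop _
  have h3 : Tendsto (fun n => -(|L n| / γ n ^ 2) - Real.log 4 / γ n ^ 2
      + 2 * (Real.log (γ n) / γ n ^ 2) + 1) atTop (𝓝 1) := by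
    simpa using ((h.neg.sub h2).add (h1.const_mul 2)).add_const 1
  refine h3.congr' ?_
  filter_upwards [hL, hγ.eventually_gt_atTop 0] with n hn hγn
  rw [abs_of_neg hn]
  field_simp

lemma tendsto_abs_div_sq_of_eventually_lt {L γ : ℕ → ℝ} (hL : ∀ᶠ n in atTop, L n < 0)
    (hγ : Tendsto γ atTop atTop)
    (h : ∀ ε, 0 < ε → ε < 1 → ∀ᶠ n in atTop, -ε * γ n ^ 2 < L n) :
    Tendsto (fun n => |L n| / γ n ^ 2) atTop (𝓝 0) := by
  refine tendsto_order.2 ⟨fun a ha => Eventually.of_forall fun n =>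
    ha.trans_le (by positivity), fun a ha => ?_⟩
  have hm : 0 < min a 2⁻¹ := lt_min ha (by norm_num)
  filter_upwards [hL, hγ.eventually_gt_atTop 0,
    h (min a 2⁻¹) hm ((min_le_right _ _).trans_lt (by norm_num))] with n hn hγn hlow
  rw [abs_of_neg hn, div_lt_iff₀ (by positivity)]
  have : min a 2⁻¹ * γ n ^ 2 ≤ a * γ n ^ 2 := by
    gcongr
    exact min_le_left _ _
  linarith

lemma eventually_energy_bound_lt {γ β : ℕ → ℝ} (hγ : Tendsto γ atTop atTop)
    (hβ : Tendsto β atTop (𝓝 (4 * Real.pi))) {ε θ : ℝ} (hθ0 : 0 < θ) (hεθ : 1 - ε < θ) (K : ℝ) :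
    ∀ᶠ n in atTop, (((1 - ε) * γ n + 1) / (2 * θ) + 1 / 2) * β n + K < 2 * Real.pi * γ n := by
  have hlim : Tendsto (fun n => 2 * Real.pi - (1 - ε) / (2 * θ) * β n) atTop
      (𝓝 (2 * Real.pi - (1 - ε) / (2 * θ) * (4 * Real.pi))) :=
    tendsto_const_nhds.sub (hβ.const_mul _)
  have hpos : 0 < 2 * Real.pi - (1 - ε) / (2 * θ) * (4 * Real.pi) := by
    have h1 : 2 * Real.pi - (1 - ε) / (2 * θ) * (4 * Real.pi)
        = 2 * Real.pi * ((θ - (1 - ε)) / θ) := by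
      field_simp
      ring
    rw [h1]
    have : 0 < (θ - (1 - ε)) / θ := div_pos (sub_pos.2 hεθ) hθ0
    have := Real.pi_pos
    positivity
  have h1 := hγ.atTop_mul_pos hpos hlim
  have h2 : Tendsto (fun n => -((1 / (2 * θ) + 1 / 2) * β n + K)) atTop
      (𝓝 (-((1 / (2 * θ) + 1 / 2) * (4 * Real.pi) + K))) :=
    ((hβ.const_mul _).add_const K).neg
  filter_upwards [(h1.atTop_add h2).eventually_gt_atTop 0] with n hn
  have h3 : (((1 - ε) * γ n + 1) / (2 * θ) + 1 / 2) * β n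
      = γ n * ((1 - ε) / (2 * θ) * β n) + (1 / (2 * θ) + 1 / 2) * β n := by
    field_simp
    ring
  rw [h3]
  linarith

/-- Under the blow-up assumptions, `|log Λ_α| = o(γ_α²)`; equivalently
`log(1/μ_α²) = (1 + o(1)) γ_α²`. -/
theorem log_Lambda_isLittleO_gamma_sq
    (Ω : Set E2) (hΩo : IsOpen Ω) (hΩb : IsBounded Ω) (hΩc : IsConnected Ω)
    (lam1 : ℝ) (hlam1 : 0 < lam1)
    (v : ℕ → E2 → ℝ) (A L : ℕ → ℝ) (x : ℕ → E2)
    (hA : ∀ n, 0 ≤ A n ∧ A n < lam1) (hLpos : ∀ n, 0 < L n)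
    (hsm : ∀ n, ContDiffOn ℝ (⊤ : ℕ∞) (v n) Ω)
    (hct : ∀ n, ContinuousOn (v n) (closure Ω))
    (hpos : ∀ n, ∀ y ∈ Ω, 0 < v n y)
    (hpde : ∀ n, ∀ y ∈ Ω, lapl (v n) y = v n y * (A n + L n * Real.exp ((v n y) ^ 2)))
    (hbd : ∀ n, ∀ y ∈ frontier Ω, v n y = 0)
    (hgint : ∀ n, IntegrableOn (fun y => ‖gradient (v n) y‖ ^ 2) Ω)
    (henergy : Tendsto (fun n => ∫ y in Ω, ‖gradient (v n) y‖ ^ 2) atTop (𝓝 (4 * Real.pi)))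
    (hAlim : Tendsto A atTop (𝓝 lam1)) (hLlim : Tendsto L atTop (𝓝 0))
    (hxΩ : ∀ n, x n ∈ Ω) (hmax : ∀ n, ∀ y ∈ Ω, v n y ≤ v n (x n))
    (hγ : Tendsto (fun n => v n (x n)) atTop atTop)
    (μ : ℕ → ℝ)
    (hμ : ∀ n, 0 < μ n ∧
      ((μ n)⁻¹) ^ 2 = L n / 4 * (v n (x n)) ^ 2 * Real.exp ((v n (x n)) ^ 2)) :
    Tendsto (fun n => |Real.log (L n)| / (v n (x n)) ^ 2) atTop (𝓝 0) ∧
    Tendsto (fun n => Real.log (1 / (μ n) ^ 2) / (v n (x n)) ^ 2) atTop (𝓝 1) := by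
  obtain ⟨r, hr⟩ := hΩb.subset_ball (0 : E2)
  have hΩd : ∀ n, Ω ⊆ ball (x n) (2 * r) := fun n y hy => by
    have h1 : dist y 0 < r := hr hy
    have h2 : dist (x n) 0 < r := hr (hxΩ n)
    rw [mem_ball]
    linarith [dist_triangle_right y (x n) 0]
  have hneg : ∀ᶠ n in atTop, Real.log (L n) < 0 := by
    filter_upwards [hLlim.eventually_lt_const one_pos] with n hn
    exact Real.log_neg (hLpos n) hn
  have hlow : ∀ ε, 0 < ε → ε < 1 → ∀ᶠ n in atTop, -ε * v n (x n) ^ 2 < Real.log (L n) := by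
    intro ε hε hε1
    obtain ⟨C, hC⟩ := exists_setIntegral_exp_logPotential_le (θ := 1 - ε / 2) (by linarith)
      (by linarith) ((2 * r) ^ 2 + 1) (2 * r)
    filter_upwards [eventually_energy_bound_lt hγ henergy (ε := ε) (θ := 1 - ε / 2)
      (by linarith) (by linarith)
      ((1 / (2 * (1 - ε / 2)) + lam1 / (2 * (1 - ε / 2) ^ 2)) * C)] with n hn
    by_contra hlog
    refine hn.not_ge (two_pi_mul_le_of_log_le hΩo (hA n).1 (hA n).2.le (hLpos n)
      ((hsm n).of_le (WithTop.coe_le_coe.2 (le_top : (2 : ℕ∞) ≤ ⊤))) (hct n) (hpos n) (hpde n) (hbd n) (hgint n)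
      (hxΩ n) (hmax n) (hΩd n) hε.le hε1.le (by linarith) (not_lt.1 hlog)
      fun δ hδ => hC Ω (x n) δ hΩo hδ (hΩd n))
  have habs := tendsto_abs_div_sq_of_eventually_lt hneg hγ hlow
  refine ⟨habs, (tendsto_log_div_sq_of_abs hneg hγ habs).congr fun n => ?_⟩
  have hv := hpos n (x n) (hxΩ n)
  have hl := hLpos n
  rw [one_div, ← inv_pow, (hμ n).2, Real.log_mul (by positivity) (by positivity),
    Real.log_mul (by positivity) (by positivity), Real.log_div hl.ne' (by norm_num),
    Real.log_pow, Real.log_exp, Nat.cast_ofNat]
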